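/- In the continuous-time defaultable bond model, set C_par = 100·r + (100 - R)·λ and c_par = C_par/100. For every maturity T > 0 and every coupon C ≥ 0 with C ≠ C_par, the yield-to-maturity satisfies |y_T(C) - c_par| < |C - C_par|/100; that is, the deviation of the yield-to-maturity from the par yield is strictly smaller in magnitude than the deviation of the coupon rate from the par yield. -/

import Mathlib

/-- Price of a defaultable coupon bond in the continuous-time intensity model. -/
noncomputable def bondPriceC (r lam R C T : ℝ) : ℝ :=
  (C + R * lam) / (r + lam) * (1 - Real.exp (-(r + lam) * T)) +
    100 * Real.exp (-(r + lam) * T)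

/-- Present value of the nominal cash flows discounted at rate `y`. -/
noncomputable def bondPVC (C y T : ℝ) : ℝ :=
  C * (∫ t in (0 : ℝ)..T, Real.exp (-y * t)) + 100 * Real.exp (-y * T)

/-- Par coupon in the continuous-time model. -/
noncomputable def parCouponC (r lam R : ℝ) : ℝ := 100 * r + (100 - R) * lam

theorem aux_anti (T : ℝ) (hT : 0 < T) (x y : ℝ) (h : x ≤ y) :
    (∫ t in (0 : ℝ)..T, Real.exp (-y * t)) ≤ ∫ t in (0 : ℝ)..T, Real.exp (-x * t) := by
  apply intervalIntegral.integral_mono_on hT.le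
  · exact (by fun_prop : Continuous fun t : ℝ => Real.exp (-y * t)).intervalIntegrable _ _
  · exact (by fun_prop : Continuous fun t : ℝ => Real.exp (-x * t)).intervalIntegrable _ _
  · intro t ht
    apply Real.exp_le_exp.mpr
    nlinarith [ht.1]

theorem aux_pos (T : ℝ) (hT : 0 < T) (x : ℝ) :
    0 < ∫ t in (0 : ℝ)..T, Real.exp (-x * t) := by
  apply intervalIntegral.intervalIntegral_pos_of_pos _ (fun t => Real.exp_pos _) hT
  exact (by fun_prop : Continuous fun t : ℝ => Real.exp (-x * t)).intervalIntegrable _ _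

theorem aux_val (T x : ℝ) :
    x * (∫ t in (0 : ℝ)..T, Real.exp (-x * t)) = 1 - Real.exp (-x * T) := by
  rw [← intervalIntegral.integral_const_mul]
  have := intervalIntegral.integral_eq_sub_of_hasDerivAt (a := 0) (b := T)
    (f := fun t => - Real.exp (-x * t)) (f' := fun t => x * Real.exp (-x * t))
    (fun t _ => by
      have h1 : HasDerivAt (fun t : ℝ => -x * t) (-x) t := by
        simpa using (hasDerivAt_id t).const_mul (-x)
      have h2 := h1.exp.fun_neg
      have e : x * Real.exp (-x * t) = -(Real.exp (-x * t) * -x) := by ring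
      rw [e]
      exact h2)
    ((by fun_prop : Continuous fun t : ℝ => x * Real.exp (-x * t)).intervalIntegrable _ _)
  rw [this]
  simp
  ring

/-- With `C_par = 100·r + (100 - R)·λ` and `c_par = C_par/100`, for every
maturity `T > 0` and coupon `C ≥ 0` with `C ≠ C_par`, the yield-to-maturity satisfies
`|y_T(C) - c_par| < |C - C_par|/100`. -/
theorem ytm_deviation_bound_continuous (r lam R : ℝ) (hr : 0 ≤ r) (hlam : 0 ≤ lam)
    (hrl : 0 < r + lam) (hR : R ∈ Set.Icc (0 : ℝ) 100)
    (T : ℝ) (hT : 0 < T) (C : ℝ) (hC : 0 ≤ C) (hne : C ≠ parCouponC r lam R)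
    (y : ℝ) (heq : bondPriceC r lam R C T = bondPVC C y T) :
    |y - parCouponC r lam R / 100| < |C - parCouponC r lam R| / 100 := by
  obtain ⟨hR0, hR1⟩ := hR
  have hpar : parCouponC r lam R = 100 * (r + lam) - R * lam := by
    unfold parCouponC; ring
  have hRl : 0 ≤ R * lam := mul_nonneg hR0 hlam
  generalize parCouponC r lam R = P at *
  unfold bondPriceC bondPVC at heq
  have hRe : R * lam = 100 * (r + lam) - P := by linarith
  rw [hRe] at heq hRl
  clear hpar hRe
  generalize r + lam = k at *
  have vk := aux_val T k
  have vy := aux_val T y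
  have v2 := aux_val T (2 * k)
  have v0 := aux_val T (2 * (P / 100) - C / 100)
  have pk := aux_pos T hT k
  have py := aux_pos T hT y
  have p2 := aux_pos T hT (2 * k)
  have an := aux_anti T hT
  have key : (C - P) * (∫ t in (0 : ℝ)..T, Real.exp (-k * t)) =
      (C - 100 * y) * ∫ t in (0 : ℝ)..T, Real.exp (-y * t) := by
    have e1 : (C + (100 * k - P)) / k * (1 - Real.exp (-k * T)) =
        (C + (100 * k - P)) * ∫ t in (0 : ℝ)..T, Real.exp (-k * t) := by
      rw [← vk]; field_simp
    rw [e1] at heq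
    linarith
  rcases lt_or_gt_of_ne hne with h | h
  · rw [abs_of_neg (sub_neg.mpr h), abs_lt]
    have hy : C < 100 * y := by
      by_contra hcon
      have : 0 ≤ (C - 100 * y) * ∫ t in (0 : ℝ)..T, Real.exp (-y * t) :=
        mul_nonneg (by linarith) py.le
      have := mul_pos (sub_pos.mpr h) pk
      linarith
    refine ⟨by linarith, ?_⟩
    by_contra hcon
    have hz : 2 * (P / 100) - C / 100 ≤ y := by linarith
    have a1 := an _ _ hz
    have a2 := an (2 * (P / 100) - C / 100) (2 * k) (by linarith)
    have ez : Real.exp (-y * T) ≤ Real.exp (-(2 * (P / 100) - C / 100) * T) := by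
      apply Real.exp_le_exp.mpr
      nlinarith
    have e2 : Real.exp (-(2 * k) * T) < Real.exp (-k * T) := by
      apply Real.exp_lt_exp.mpr
      nlinarith
    have b : (∫ t in (0 : ℝ)..T, Real.exp (-k * t)) <
        2 * ∫ t in (0 : ℝ)..T, Real.exp (-(2 * k) * t) := by
      apply lt_of_mul_lt_mul_left _ hrl.le
      linarith
    have c1 := mul_le_mul_of_nonneg_left a1 hC
    have c2 := mul_lt_mul_of_pos_left (b.trans_le (mul_le_mul_of_nonneg_left a2 zero_le_two))
      (sub_pos.mpr h)
    linarith
  · rw [abs_of_pos (sub_pos.mpr h), abs_lt]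
    have hy : 100 * y < C := by
      by_contra hcon
      have : 0 ≤ (100 * y - C) * ∫ t in (0 : ℝ)..T, Real.exp (-y * t) :=
        mul_nonneg (by linarith) py.le
      have := mul_pos (sub_pos.mpr h) pk
      linarith
    refine ⟨?_, by linarith⟩
    by_contra hcon
    have a := an y k (by linarith)
    have c1 := mul_le_mul_of_nonneg_left a (sub_pos.mpr h).le
    have c2 : 0 ≤ (C - 100 * y - 2 * (C - P)) * ∫ t in (0 : ℝ)..T, Real.exp (-y * t) :=
      mul_nonneg (by linarith) py.le
    have c3 := mul_pos (sub_pos.mpr h) py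
    linarith
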